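/- arXiv:0906.1716 — 2 statements merged into one kernel-verified Lean document; each statement's English description precedes it below -/
import Mathlib

section
/- For any real numbers γ_1, γ_2, γ_3 ≥ 0 with γ_1 + γ_2 + γ_3 > 0 and any function g : S_4 → ℝ, ∑_{σ ∈ S_4} ∑_{i=1}^{3} γ_i [g(σ) − g((i 4)σ)]^2 ≥ ∑_{σ ∈ S_4} ∑_{1≤i<j≤3} (γ_i γ_j / (γ_1 + γ_2 + γ_3)) [g(σ) − g((i j)σ)]^2. -/
open BigOperators Equiv

/-- The autocorrelation of a function on a finite group. -/
def autocorr {G : Type*} [Group G] [Fintype G] (g : G → ℝ) (π : G) : ℝ :=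
  ∑ σ : G, g σ * g (π * σ)

section Autocorrelation

variable {G : Type*} [Group G] [Fintype G] (g : G → ℝ)

lemma sum_translate_mul (π ρ : G) :
    ∑ σ : G, g (π * σ) * g (ρ * σ) = autocorr g (ρ * π⁻¹) :=
  Fintype.sum_equiv (Equiv.mulLeft π) _ _ fun σ => by simp [mul_assoc]

lemma sum_sub_translate_sq (π : G) :
    ∑ σ : G, (g σ - g (π * σ)) ^ 2 = 2 * (autocorr g 1 - autocorr g π) := by
  have h₁ := sum_translate_mul g 1 1
  have h₂ := sum_translate_mul g π π
  have h₃ := sum_translate_mul g 1 π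
  simp only [one_mul, inv_one, mul_one, mul_inv_cancel] at h₁ h₂ h₃
  have : ∀ σ, (g σ - g (π * σ)) ^ 2 =
      g σ * g σ + g (π * σ) * g (π * σ) - 2 * (g σ * g (π * σ)) := fun σ => by ring
  simp only [this, Finset.sum_sub_distrib, Finset.sum_add_distrib, ← Finset.mul_sum, h₁, h₂, h₃]
  ring

lemma autocorr_inv (π : G) : autocorr g π⁻¹ = autocorr g π := by
  have h := sum_translate_mul g π 1
  simp only [one_mul] at h
  rw [← h, autocorr]
  exact Finset.sum_congr rfl fun σ _ => mul_comm _ _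

/-- The autocorrelation is a function of positive type. -/
lemma autocorr_nonneg {ι : Type*} [Fintype ι] (a : ι → ℝ) (p : ι → G) :
    0 ≤ ∑ k, ∑ l, a k * a l * autocorr g (p l * (p k)⁻¹) := by
  have : ∑ σ : G, (∑ k, a k * g (p k * σ)) ^ 2 =
      ∑ k, ∑ l, a k * a l * autocorr g (p l * (p k)⁻¹) := by
    simp_rw [← sum_translate_mul, Finset.mul_sum, sq, Finset.sum_mul_sum]
    rw [Finset.sum_comm]
    refine Finset.sum_congr rfl fun k _ => ?_
    rw [Finset.sum_comm]
    exact Finset.sum_congr rfl fun l _ => Finset.sum_congr rfl fun σ _ => by ring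
  rw [← this]
  positivity

end Autocorrelation

/-- A function of a permutation of `Fin 4` is a function of its four values. -/
lemma exists_eq_apply_values (E : Perm (Fin 4) → ℝ) :
    ∃ F : Fin 4 → Fin 4 → Fin 4 → Fin 4 → ℝ, ∀ π, E π = F (π 0) (π 1) (π 2) (π 3) := by
  refine ⟨fun a b c d => E (Function.invFun (fun π : Perm (Fin 4) => ⇑π) ![a, b, c, d]),
    fun π => ?_⟩
  have h : ![π 0, π 1, π 2, π 3] = ⇑π := by
    ext i
    fin_cases i <;> rfl
  simp only [h]
  exact congrArg E (Function.leftInverse_invFun DFunLike.coe_injective π).symm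

/-- The octopus inequality on four points, in terms of the autocorrelation. -/
lemma octopus_autocorr (g : Perm (Fin 4) → ℝ) {x y z : ℝ} (hx : 0 ≤ x) (hy : 0 ≤ y) (hz : 0 ≤ z)
    (hpos : 0 < x + y + z) :
    0 ≤ (x + y + z) * (x * (autocorr g 1 - autocorr g (swap 0 3)) +
        y * (autocorr g 1 - autocorr g (swap 1 3)) + z * (autocorr g 1 - autocorr g (swap 2 3))) -
      (x * y * (autocorr g 1 - autocorr g (swap 0 1)) +
        x * z * (autocorr g 1 - autocorr g (swap 0 2)) +
        y * z * (autocorr g 1 - autocorr g (swap 1 2))) := by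
  obtain ⟨w, hw⟩ : ∃ w, w = -(x + y + z) := ⟨_, rfl⟩
  obtain ⟨c, hc⟩ : ∃ c, c = (x ^ 2 + y ^ 2 + z ^ 2 + w ^ 2) / 2 := ⟨_, rfl⟩
  have hc0 : 0 < c := by
    have : w ≠ 0 := by rw [hw]; linarith
    rw [hc]; positivity
  have h₁ := autocorr_nonneg g ![c, x * y, x * z, x * w, y * z, y * w, z * w]
    ![1, swap 0 1, swap 0 2, swap 0 3, swap 1 2, swap 1 3, swap 2 3]
  have h₂ := autocorr_nonneg g ![1, 1, 1, 1, -1, -1, -1, -1]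
    ![1, swap 0 1 * swap 2 3, swap 0 2 * swap 1 3, swap 0 3 * swap 1 2,
      swap 0 1 * swap 1 2, swap 0 1 * swap 1 2 * (swap 0 1 * swap 2 3),
      swap 0 1 * swap 1 2 * (swap 0 2 * swap 1 3), swap 0 1 * swap 1 2 * (swap 0 3 * swap 1 2)]
  obtain ⟨F, hF⟩ := exists_eq_apply_values (autocorr g)
  have i₁ := autocorr_inv g (swap 0 1 * swap 1 2)
  have i₂ := autocorr_inv g (swap 0 1 * swap 1 3)
  have i₃ := autocorr_inv g (swap 0 2 * swap 2 3)
  have i₄ := autocorr_inv g (swap 1 2 * swap 2 3)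
  simp only [hF, mul_inv_rev, swap_inv] at i₁ i₂ i₃ i₄
  simp [swap_apply_def] at i₁ i₂ i₃ i₄
  simp only [hF, Fin.sum_univ_succ, Fin.sum_univ_zero] at h₁ h₂ ⊢
  simp [swap_apply_def, -sub_nonneg] at h₁ h₂ ⊢
  simp only [i₁, i₂, i₃, i₄] at h₁ h₂
  have hw₄ : 0 ≤ x * y * z * (x + y + z) / 4 := by positivity
  refine nonneg_of_mul_nonneg_right ?_ (mul_pos two_pos hc0)
  refine (add_nonneg h₁ (mul_nonneg hw₄ h₂)).trans_eq ?_
  rw [hc, hw]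
  ring

theorem stmt3 (γ : Fin 3 → ℝ) (hγ : ∀ i, 0 ≤ γ i) (hpos : 0 < γ 0 + γ 1 + γ 2)
    (g : Equiv.Perm (Fin 4) → ℝ) :
    ∑ σ : Equiv.Perm (Fin 4), ∑ i : Fin 3,
        γ i * (g σ - g (Equiv.swap i.castSucc (3 : Fin 4) * σ)) ^ 2 ≥
    ∑ σ : Equiv.Perm (Fin 4), ∑ i : Fin 3, ∑ j : Fin 3,
        if i < j then
          γ i * γ j / (γ 0 + γ 1 + γ 2) *
            (g σ - g (Equiv.swap i.castSucc j.castSucc * σ)) ^ 2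
        else 0 := by
  have h := octopus_autocorr g (hγ 0) (hγ 1) (hγ 2) hpos
  have e0 : Fin.castSucc (0 : Fin 3) = (0 : Fin 4) := rfl
  have e1 : Fin.castSucc (1 : Fin 3) = (1 : Fin 4) := rfl
  have e2 : Fin.castSucc (2 : Fin 3) = (2 : Fin 4) := rfl
  have l01 : (0 : Fin 3) < 1 := by decide
  have l02 : (0 : Fin 3) < 2 := by decide
  have l12 : (1 : Fin 3) < 2 := by decide
  simp only [Fin.sum_univ_three, e0, e1, e2, lt_irrefl, l01, l02, l12, l01.not_gt, l02.not_gt,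
    l12.not_gt, if_true, if_false, add_zero, zero_add, Finset.sum_add_distrib, ← Finset.mul_sum,
    sum_sub_translate_sq]
  rw [ge_iff_le, ← sub_nonneg]
  refine (div_nonneg (mul_nonneg zero_le_two h) hpos.le).trans_eq ?_
  field_simp
  ring
end

section
/- For any k ≥ 2, any γ ≥ 0, and any function g : S_k → ℝ, ∑_{σ ∈ S_k} ∑_{i=1}^{k-1} γ [g(σ) − g((i k)σ)]^2 ≥ ∑_{σ ∈ S_k} ∑_{1≤i<j≤k-1} (γ/(k−1)) [g(σ) − g((i j)σ)]^2. -/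
open BigOperators Equiv

section ContentSequences

theorem abs_sub_le_of_swap_closed {S : Set (ℕ → ℝ)} {N : ℕ} (h0 : ∀ c ∈ S, c 0 = 0)
    (hS : ∀ c ∈ S, ∀ p, p + 1 < N →
      c (p + 1) = c p + 1 ∨ c (p + 1) = c p - 1 ∨ c ∘ swap p (p + 1) ∈ S)
    (k : ℕ) (hk : k < N) : ∀ c ∈ S, ∀ m < k, |c k - c m| ≤ k := by
  induction k with
  | zero => intro c hc m hm; omega
  | succ k ih =>
    intro c hc m hm
    have ih := ih (by omega)
    have self : ∀ (c : ℕ → ℝ), c ∘ swap k (k + 1) ∈ S → ∀ m < k, |c (k + 1) - c m| ≤ k := by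
      intro c hc m hm
      have := ih _ hc m hm
      simpa [swap_apply_of_ne_of_ne (show m ≠ k by omega) (show m ≠ k + 1 by omega)] using this
    push_cast
    rcases Nat.lt_succ_iff_lt_or_eq.mp hm with hm | rfl
    · rcases hS c hc k hk with h | h | h
      · have := ih c hc m hm
        rw [abs_le] at *; constructor <;> linarith
      · have := ih c hc m hm
        rw [abs_le] at *; constructor <;> linarith
      · linarith [self c h m hm]
    · rcases hS c hc m hk with h | h | h
      · rw [h]; simp
      · rw [h]; simp
      rcases m with _ | j
      · have h1 := h0 _ h
        have h2 := h0 _ hc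
        simp at h1
        simp [h1, h2]
      have key := self c h j (by omega)
      rcases hS c hc j (by omega) with h' | h' | h'
      · push_cast at *
        rw [abs_le] at *; constructor <;> linarith
      · push_cast at *
        rw [abs_le] at *; constructor <;> linarith
      have e1 : swap j (j + 1) (j + 1 + 1) = j + 1 + 1 := swap_apply_of_ne_of_ne (by omega) (by omega)
      have key2 := ih _ hc j (by omega)
      rcases hS _ h' (j + 1) hk with h2 | h2 | h2
      · simp only [Function.comp, swap_apply_right, e1] at h2
        push_cast at *
        rw [abs_le] at *; constructor <;> linarith
      · simp only [Function.comp, swap_apply_right, e1] at h2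
        push_cast at *
        rw [abs_le] at *; constructor <;> linarith
      · have := self _ h2 j (by omega)
        simp only [Function.comp, swap_apply_left, e1] at this
        linarith

theorem sum_sub_add_nonneg_of_swap_closed {S : Set (ℕ → ℝ)} {N : ℕ} (h0 : ∀ c ∈ S, c 0 = 0)
    (hS : ∀ c ∈ S, ∀ p, p + 1 < N →
      c (p + 1) = c p + 1 ∨ c (p + 1) = c p - 1 ∨ c ∘ swap p (p + 1) ∈ S)
    (k : ℕ) (hk : k < N) : ∀ c ∈ S, 0 ≤ ∑ m ∈ Finset.range k, (c m - c k + (k - m)) := by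
  induction k with
  | zero => simp
  | succ k ih =>
    intro c hc
    have ih := ih (by omega)
    rw [Finset.sum_range_succ]
    have key : ∀ d : ℝ, ∑ m ∈ Finset.range k, (c m - c (k + 1) + (((k + 1 : ℕ) : ℝ) - m)) =
        ∑ m ∈ Finset.range k, (c m - d + (k - m)) + k * (d - c (k + 1) + 1) := by
      intro d
      rw [← sub_eq_iff_eq_add', ← Finset.sum_sub_distrib]
      rw [Finset.sum_congr rfl (g := fun _ => d - c (k + 1) + 1) (fun m _ => by push_cast; ring)]
      rw [Finset.sum_const, Finset.card_range, nsmul_eq_mul]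
    rcases hS c hc k hk with h | h | h
    · rw [key (c k), h]
      have := ih c hc
      push_cast
      linarith
    · rw [key (c k), h]
      have := ih c hc
      push_cast
      nlinarith [Nat.cast_nonneg (α := ℝ) k]
    · rw [key (c (k + 1))]
      have h1 := ih _ h
      have h2 := (abs_le.mp (abs_sub_le_of_swap_closed h0 hS (k + 1) hk c hc k (by omega))).2
      have h3 : ∑ m ∈ Finset.range k, ((c ∘ swap k (k + 1)) m - (c ∘ swap k (k + 1)) k + ((k : ℝ) - m))
          = ∑ m ∈ Finset.range k, (c m - c (k + 1) + (k - m)) := by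
        refine Finset.sum_congr rfl fun m hm => ?_
        have := Finset.mem_range.mp hm
        simp [swap_apply_of_ne_of_ne (show m ≠ k by omega) (show m ≠ k + 1 by omega)]
      rw [h3] at h1
      push_cast at *
      linarith
end ContentSequences

section JucysMurphy

open Module

variable {N : ℕ} {V : Type*} [AddCommGroup V] [Module ℝ V]

/-- The image of the Jucys–Murphy element `∑_{i < m} (i m)` under a representation. -/
def jucysMurphy (ρ : Perm (Fin N) →* End ℝ V) (m : Fin N) : End ℝ V :=
  ∑ i ∈ Finset.Iio m, ρ (swap i m)

/-- The simultaneous eigenvalues of the Jucys–Murphy elements. -/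
def contents (ρ : Perm (Fin N) →* End ℝ V) : Set (ℕ → ℝ) :=
  {c | ∃ v ≠ 0, ∀ m : Fin N, jucysMurphy ρ m v = c m • v}

variable (ρ : Perm (Fin N) →* End ℝ V)

theorem commute_jucysMurphy_of_lt {a b m : Fin N} (ha : a < m) (hb : b < m) :
    Commute (ρ (swap a b)) (jucysMurphy ρ m) := by
  have hm : swap a b m = m := swap_apply_of_ne_of_ne ha.ne' hb.ne'
  unfold jucysMurphy Commute SemiconjBy
  rw [Finset.mul_sum, Finset.sum_mul]
  have hmem : ∀ i ∈ Finset.Iio m, swap a b i ∈ Finset.Iio m := by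
    intro i hi
    rw [Finset.mem_Iio] at hi ⊢
    rw [swap_apply_def]
    split_ifs <;> assumption
  refine Finset.sum_nbij' (swap a b) (swap a b) hmem hmem (by simp) (by simp) ?_
  intro i hi
  rw [← map_mul, ← map_mul, mul_swap_eq_swap_mul, hm]

theorem commute_jucysMurphy_of_gt {a b m : Fin N} (ha : m < a) (hb : m < b) :
    Commute (ρ (swap a b)) (jucysMurphy ρ m) := by
  refine Commute.sum_right _ _ _ fun i hi => ?_
  have hi : i < m := by simpa using hi
  unfold Commute SemiconjBy
  rw [← map_mul, ← map_mul, mul_swap_eq_swap_mul,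
    swap_apply_of_ne_of_ne (hi.trans ha).ne (hi.trans hb).ne, swap_apply_of_ne_of_ne ha.ne hb.ne]

theorem commute_jucysMurphy (a b : Fin N) : Commute (jucysMurphy ρ a) (jucysMurphy ρ b) := by
  wlog h : a < b generalizing a b
  · rcases eq_or_ne a b with rfl | hab
    · exact Commute.refl _
    · exact (this b a (lt_of_le_of_ne (not_lt.mp h) hab.symm)).symm
  refine Commute.sum_left _ _ _ fun i hi => ?_
  exact commute_jucysMurphy_of_lt ρ ((Finset.mem_Iio.mp hi).trans h) h

theorem swap_mul_jucysMurphy {p q : Fin N} (h : (q : ℕ) = p + 1) :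
    ρ (swap p q) * jucysMurphy ρ p = jucysMurphy ρ q * ρ (swap p q) - 1 := by
  have hI : Finset.Iio q = insert p (Finset.Iio p) := by
    ext i
    simp only [Finset.mem_Iio, Finset.mem_insert, Fin.lt_def, Fin.ext_iff]
    omega
  unfold jucysMurphy
  rw [hI, Finset.sum_insert (by simp), add_mul, ← map_mul, swap_mul_self, map_one,
    add_sub_cancel_left, Finset.mul_sum, Finset.sum_mul]
  refine Finset.sum_congr rfl fun i hi => ?_
  have hi : i < p := by simpa using hi
  have hpq : p < q := by rw [Fin.lt_def]; omega
  rw [← map_mul, ← map_mul, mul_swap_eq_swap_mul, swap_apply_left,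
    swap_apply_of_ne_of_ne hi.ne (hi.trans hpq).ne]

theorem contents_zero {c : ℕ → ℝ} (hc : c ∈ contents ρ) (hN : 0 < N) : c 0 = 0 := by
  obtain ⟨v, hv, h⟩ := hc
  have := h ⟨0, hN⟩
  have hI : Finset.Iio (⟨0, hN⟩ : Fin N) = ∅ := by
    ext i
    simp [Fin.lt_def]
  rw [jucysMurphy, hI] at this
  simpa [hv] using this.symm

theorem contents_swap {c : ℕ → ℝ} (hc : c ∈ contents ρ) (p : ℕ) (hp : p + 1 < N) :
    c (p + 1) = c p + 1 ∨ c (p + 1) = c p - 1 ∨ c ∘ swap p (p + 1) ∈ contents ρ := by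
  obtain ⟨v, hv, h⟩ := hc
  let P : Fin N := ⟨p, by omega⟩
  let Q : Fin N := ⟨p + 1, hp⟩
  set s := ρ (swap P Q) with hs
  have hss : ∀ x, s (s x) = x := fun x => by
    rw [← End.mul_apply, hs, ← map_mul, swap_mul_self, map_one, End.one_apply]
  have h1 : s * jucysMurphy ρ P = jucysMurphy ρ Q * s - 1 := swap_mul_jucysMurphy ρ rfl
  have hPv : jucysMurphy ρ P v = c p • v := h P
  have hQv : jucysMurphy ρ Q v = c (p + 1) • v := h Q
  have hQs : jucysMurphy ρ Q (s v) = c p • s v + v := by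
    have := congrArg (fun f => f v) h1
    simp only [End.mul_apply, LinearMap.sub_apply, End.one_apply, hPv, map_smul] at this
    rw [this]; simp
  have hPs : jucysMurphy ρ P (s v) = c (p + 1) • s v - v := by
    have := congrArg (fun f => s (f (s v))) h1
    simp only [End.mul_apply, LinearMap.sub_apply, End.one_apply, hss, hQv, map_sub, map_smul]
      at this
    exact this
  set d := c (p + 1) - c p with hd
  by_cases hw : d • s v - v = 0
  · have e1 : d • s v = v := sub_eq_zero.mp hw
    have e2 : d • v = s v := by
      have := congrArg s e1
      rwa [map_smul, hss] at this
    have e3 : (d * d - 1) • v = 0 := by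
      rw [sub_smul, mul_smul, e2, e1, one_smul, sub_self]
    have e4 : (d - 1) * (d + 1) = 0 := by
      have := (smul_eq_zero.mp e3).resolve_right hv
      linarith
    rcases mul_eq_zero.mp e4 with e | e
    · left; linarith
    · right; left; linarith
  · refine Or.inr (Or.inr ⟨_, hw, fun m => ?_⟩)
    by_cases hmP : m = P
    · subst hmP
      change jucysMurphy ρ P _ = c (swap p (p + 1) p) • _
      rw [swap_apply_left, map_sub, map_smul, hPs, hPv, hd]
      module
    by_cases hmQ : m = Q
    · subst hmQ
      change jucysMurphy ρ Q _ = c (swap p (p + 1) (p + 1)) • _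
      rw [swap_apply_right, map_sub, map_smul, hQs, hQv, hd]
      module
    have n1 : (m : ℕ) ≠ p := fun e => hmP (Fin.ext e)
    have n2 : (m : ℕ) ≠ p + 1 := fun e => hmQ (Fin.ext e)
    have hcomm : Commute s (jucysMurphy ρ m) := by
      rcases lt_or_gt_of_ne n1 with hlt | hgt
      · exact commute_jucysMurphy_of_gt ρ (Fin.lt_def.mpr hlt)
          (Fin.lt_def.mpr (show (m : ℕ) < p + 1 by omega))
      · exact commute_jucysMurphy_of_lt ρ (Fin.lt_def.mpr hgt)
          (Fin.lt_def.mpr (show p + 1 < (m : ℕ) by omega))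
    have hms : jucysMurphy ρ m (s v) = c m • s v := by
      rw [← End.mul_apply, ← hcomm.eq, End.mul_apply, h m, map_smul]
    simp only [map_sub, map_smul, hms, h m, Function.comp, swap_apply_of_ne_of_ne n1 n2]
    module

end JucysMurphy

section Positivity

open Module

variable {E : Type*} [NormedAddCommGroup E] [InnerProductSpace ℝ E]

theorem inner_nonneg_of_joint_eigenvectors [FiniteDimensional ℝ E] {ι : Type*} {T : ι → End ℝ E}
    (hT : ∀ i, (T i).IsSymmetric) (hC : ∀ i j, Commute (T i) (T j)) (A : End ℝ E)
    (hA : ∀ (χ : ι → ℝ) (v : E), v ≠ 0 → (∀ i, T i v = χ i • v) → ∃ a : ℝ, 0 ≤ a ∧ A v = a • v)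
    (g : E) : 0 ≤ inner ℝ (A g) g := by
  have htop := LinearMap.IsSymmetric.iSup_iInf_eq_top_of_commute hT (fun i j _ => hC i j)
  have hg : g ∈ ⨆ χ : ι → ℝ, ⨅ i, End.eigenspace (T i) (χ i) := htop ▸ Submodule.mem_top
  obtain ⟨f, hf, rfl⟩ := (Submodule.mem_iSup_iff_exists_finsupp _ _).mp hg
  have hmem : ∀ χ i, T i (f χ) = χ i • f χ := fun χ i =>
    End.mem_eigenspace_iff.mp ((Submodule.mem_iInf _).mp (hf χ) i)
  rw [Finsupp.sum, map_sum, sum_inner]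
  refine Finset.sum_nonneg fun χ _ => ?_
  rw [inner_sum]
  refine Finset.sum_nonneg fun ψ _ => ?_
  by_cases h0 : f χ = 0
  · simp [h0]
  obtain ⟨a, ha, e⟩ := hA χ (f χ) h0 (hmem χ)
  rw [e, real_inner_smul_left]
  refine mul_nonneg ha ?_
  by_cases hχ : χ = ψ
  · subst hχ
    exact real_inner_self_nonneg
  · exact (LinearMap.IsSymmetric.orthogonalFamily_iInf_eigenspaces hT hχ
      ⟨_, hf χ⟩ ⟨_, hf ψ⟩).ge

theorem isSymmetric_jucysMurphy {N : ℕ} (ρ : Perm (Fin N) →* End ℝ E)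
    (hρ : ∀ i j, (ρ (swap i j)).IsSymmetric) (m : Fin N) : (jucysMurphy ρ m).IsSymmetric := by
  intro x y
  simp [jucysMurphy, LinearMap.sum_apply, sum_inner, inner_sum, hρ _ _ x y]

theorem inner_jucysMurphy_last_le [FiniteDimensional ℝ E] {n : ℕ}
    (ρ : Perm (Fin (n + 1)) →* End ℝ E)
    (hρ : ∀ i j, (ρ (swap i j)).IsSymmetric) (g : E) :
    ∑ j : Fin n, ((j : ℝ) * inner ℝ g g - inner ℝ (jucysMurphy ρ j.castSucc g) g) ≤
      n * (n * inner ℝ g g - inner ℝ (jucysMurphy ρ (Fin.last n) g) g) := by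
  have key := inner_nonneg_of_joint_eigenvectors (isSymmetric_jucysMurphy ρ hρ)
    (commute_jucysMurphy ρ)
    (∑ j : Fin n, (jucysMurphy ρ j.castSucc - jucysMurphy ρ (Fin.last n) + ((n : ℝ) - j) • 1))
    (fun χ v hv h => by
      let c : ℕ → ℝ := fun m => if hm : m < n + 1 then χ ⟨m, hm⟩ else 0
      have hcm : ∀ m : Fin (n + 1), c m = χ m := fun m => dif_pos m.isLt
      have hc : c ∈ contents ρ := ⟨v, hv, fun m => by rw [h m, hcm]⟩
      refine ⟨_, sum_sub_add_nonneg_of_swap_closed (fun c hc => contents_zero ρ hc n.succ_pos)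
        (fun c hc => contents_swap ρ hc) n n.lt_succ_self c hc, ?_⟩
      rw [Finset.sum_range, LinearMap.sum_apply, Finset.sum_smul]
      refine Finset.sum_congr rfl fun j _ => ?_
      have e1 : c j = χ j.castSucc := hcm j.castSucc
      have e2 : c n = χ (Fin.last n) := hcm (Fin.last n)
      simp only [LinearMap.add_apply, LinearMap.sub_apply, LinearMap.smul_apply, End.one_apply, h,
        e1, e2]
      module) g
  rw [LinearMap.sum_apply, sum_inner] at key
  rw [← sub_nonneg]
  refine key.trans_eq ?_
  have : (n : ℝ) * (n * inner ℝ g g - inner ℝ (jucysMurphy ρ (Fin.last n) g) g) =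
      ∑ j : Fin n, (n * inner ℝ g g - inner ℝ (jucysMurphy ρ (Fin.last n) g) g) := by
    rw [Finset.sum_const, Finset.card_univ, Fintype.card_fin, nsmul_eq_mul]
  rw [this, ← Finset.sum_sub_distrib]
  refine Finset.sum_congr rfl fun j _ => ?_
  simp only [LinearMap.add_apply, LinearMap.sub_apply, LinearMap.smul_apply, End.one_apply,
    inner_add_left, inner_sub_left, real_inner_smul_left]
  ring

end Positivity

section LeftRegular

open Module

variable (G : Type*) [Group G] [Fintype G]

/-- The left regular representation of a finite group on its real-valued functions. -/
noncomputable def leftRegular : G →* End ℝ (EuclideanSpace ℝ G) where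
  toFun τ := (LinearIsometryEquiv.piLpCongrLeft 2 ℝ ℝ (Equiv.mulLeft τ)).toLinearEquiv.toLinearMap
  map_one' := by
    refine LinearMap.ext fun f => PiLp.ext fun x => ?_
    change f (1⁻¹ * x) = f x
    rw [inv_one, one_mul]
  map_mul' a b := by
    refine LinearMap.ext fun f => PiLp.ext fun x => ?_
    change f ((a * b)⁻¹ * x) = f (b⁻¹ * (a⁻¹ * x))
    rw [mul_inv_rev, mul_assoc]

variable {G}

@[simp]
theorem leftRegular_apply (τ : G) (f : EuclideanSpace ℝ G) (x : G) :
    leftRegular G τ f x = f (τ⁻¹ * x) := by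
  simp [leftRegular, LinearIsometryEquiv.piLpCongrLeft_apply]

theorem isSymmetric_leftRegular {τ : G} (hτ : τ⁻¹ = τ) : (leftRegular G τ).IsSymmetric := by
  intro f g
  simp only [PiLp.inner_apply, leftRegular_apply, hτ]
  refine Fintype.sum_equiv (Equiv.mulLeft τ) _ _ fun x => ?_
  have : τ * τ = 1 := by nth_rw 1 [← hτ]; simp
  simp [← mul_assoc, this]

theorem sum_sub_sq_eq_inner {τ : G} (hτ : τ⁻¹ = τ) (g : EuclideanSpace ℝ G) :
    ∑ σ, (g σ - g (τ * σ)) ^ 2 = 2 * (inner ℝ g g - inner ℝ (leftRegular G τ g) g) := by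
  have h : ∑ σ, g (τ * σ) ^ 2 = ∑ σ, g σ ^ 2 := Equiv.sum_comp (Equiv.mulLeft τ) fun σ => g σ ^ 2
  have h2 : ∑ σ, (g σ - g (τ * σ)) ^ 2 =
      ∑ σ, g σ ^ 2 + ∑ σ, g (τ * σ) ^ 2 - 2 * ∑ σ, g σ * g (τ * σ) := by
    rw [Finset.mul_sum, ← Finset.sum_add_distrib, ← Finset.sum_sub_distrib]
    exact Finset.sum_congr rfl fun σ _ => by ring
  rw [h2, h]
  simp only [PiLp.inner_apply, leftRegular_apply, hτ, RCLike.inner_apply, conj_trivial, ← sq]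
  ring

end LeftRegular

theorem sum_Iio_dirichlet {N : ℕ} (m : Fin N) (g : EuclideanSpace ℝ (Perm (Fin N))) :
    ∑ i ∈ Finset.Iio m, ∑ σ, (g σ - g (swap i m * σ)) ^ 2 =
      2 * (m * inner ℝ g g - inner ℝ (jucysMurphy (leftRegular _) m g) g) := by
  simp only [sum_sub_sq_eq_inner (swap_inv _ _), ← Finset.mul_sum, Finset.sum_sub_distrib,
    jucysMurphy, LinearMap.sum_apply, sum_inner]
  simp

theorem stmt5 (n : ℕ) (hn : 1 ≤ n) (γ : ℝ) (hγ : 0 ≤ γ)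
    (g : Equiv.Perm (Fin (n+1)) → ℝ) :
    ∑ σ : Equiv.Perm (Fin (n+1)), ∑ i : Fin n,
        γ * (g σ - g (Equiv.swap i.castSucc (Fin.last n) * σ)) ^ 2 ≥
    ∑ σ : Equiv.Perm (Fin (n+1)), ∑ i : Fin n, ∑ j : Fin n,
        if i < j then
          γ / n * (g σ - g (Equiv.swap i.castSucc j.castSucc * σ)) ^ 2
        else 0 := by
  let f : EuclideanSpace ℝ (Perm (Fin (n + 1))) := WithLp.toLp 2 g
  let D (a b : Fin (n + 1)) : ℝ := ∑ σ, (f σ - f (swap a b * σ)) ^ 2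
  have key := inner_jucysMurphy_last_le (leftRegular (Perm (Fin (n + 1))))
    (fun i j => isSymmetric_leftRegular (swap_inv i j)) f
  have hlast : ∑ i : Fin n, D i.castSucc (Fin.last n) =
      2 * (n * inner ℝ f f - inner ℝ (jucysMurphy (leftRegular _) (Fin.last n) f) f) := by
    have := sum_Iio_dirichlet (Fin.last n) f
    rw [Fin.Iio_last_eq_map, Finset.sum_map] at this
    simpa using this
  have hcast (j : Fin n) : ∑ i : Fin n, (if i < j then D i.castSucc j.castSucc else 0) =
      2 * (j * inner ℝ f f - inner ℝ (jucysMurphy (leftRegular _) j.castSucc f) f) := by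
    have := sum_Iio_dirichlet j.castSucc f
    rw [Fin.Iio_castSucc, Finset.sum_map] at this
    rw [← Finset.sum_filter]
    have hfil : Finset.univ.filter (· < j) = Finset.Iio j := by ext; simp
    rw [hfil]
    simpa using this
  have hL : ∑ σ : Perm (Fin (n + 1)), ∑ i : Fin n,
      γ * (g σ - g (swap i.castSucc (Fin.last n) * σ)) ^ 2 =
      γ * ∑ i : Fin n, D i.castSucc (Fin.last n) := by
    rw [Finset.sum_comm]
    simp only [D, f, Finset.mul_sum]
  have hR : (∑ σ : Perm (Fin (n + 1)), ∑ i : Fin n, ∑ j : Fin n,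
      if i < j then γ / n * (g σ - g (swap i.castSucc j.castSucc * σ)) ^ 2 else 0) =
      γ / n * ∑ j : Fin n, ∑ i : Fin n, (if i < j then D i.castSucc j.castSucc else 0) := by
    rw [Finset.sum_comm, Finset.sum_congr rfl fun i _ => Finset.sum_comm, Finset.sum_comm,
      Finset.mul_sum]
    refine Finset.sum_congr rfl fun j _ => ?_
    rw [Finset.mul_sum]
    refine Finset.sum_congr rfl fun i _ => ?_
    split_ifs
    · exact (Finset.mul_sum _ _ _).symm
    · simp
  have hn0 : (0 : ℝ) < n := by exact_mod_cast hn
  rw [hL, hR, hlast, Finset.sum_congr rfl fun j _ => hcast j, ← Finset.mul_sum, ge_iff_le,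
    div_mul_eq_mul_div, div_le_iff₀ hn0]
  nlinarith [mul_le_mul_of_nonneg_left key hγ]
end
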